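/- arXiv:2209.12126 — 2 statements merged into one kernel-verified Lean document; each statement's English description precedes it below -/
import Mathlib

section
/- Let n ≥ 3 and 1 ≤ r ≤ n−2 be integers and let G be any n-dimensional hypercube-like network (G ∈ HL_n). Then there exists a set F of edges of G with |F| = 2^r·(n−r) − n + 1 such that the minimum degree of G − F is at least r but G − F is not strongly Menger edge connected. -/
/-- `IsHL n G` : `G` is an `n`-dimensional hypercube-like network (`G ∈ HL_n`).
`HL_0 = {K_1}`, and `G ∈ HL_n` iff the vertex set can be partitioned into `S` and `Sᶜ`
with both induced subgraphs in `HL_{n-1}` and the edges between `S` and `Sᶜ`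
forming a perfect matching between them. -/
def IsHL : (n : ℕ) → {V : Type} → [Fintype V] → [DecidableEq V] → SimpleGraph V → Prop
  | 0, V, _, _, _ => Fintype.card V = 1
  | n + 1, _, _, _, G =>
      ∃ S : Finset _,
        IsHL n (G.induce (S : Set _)) ∧
        IsHL n (G.induce ((Sᶜ : Finset _) : Set _)) ∧
        (∀ v ∈ S, ∃! w, w ∉ S ∧ G.Adj v w) ∧
        (∀ v ∉ S, ∃! w, w ∈ S ∧ G.Adj v w)

/-- `H` is strongly Menger edge connected (SM-λ): `H` is connected and, for every pair of
distinct vertices `u, v`, no set of fewer than `min (deg u) (deg v)` edges of `H`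
separates `u` from `v` (equivalently, by Menger's theorem, `u` and `v` are joined by
`min (deg u) (deg v)` pairwise edge-disjoint paths). -/
def IsSMLambda {V : Type} [Fintype V] (H : SimpleGraph V) : Prop :=
  H.Connected ∧
    ∀ u v : V, u ≠ v →
      ∀ D : Set (Sym2 V), D ⊆ H.edgeSet →
        D.ncard < min (H.neighborSet u).ncard (H.neighborSet v).ncard →
          (H.deleteEdges D).Reachable u v

/-- A vertex of `T` with exactly one neighbour outside `T` has one more neighbour in `G` than in
`G.induce T`. -/
theorem ncard_neighborSet_of_existsUnique_notMem {V : Type} [Finite V] (G : SimpleGraph V)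
    (T : Set V) (v : T) (h : ∃! w, w ∉ T ∧ G.Adj v w) :
    (G.neighborSet v).ncard = ((G.induce T).neighborSet v).ncard + 1 := by
  obtain ⟨w, ⟨hwT, hw⟩, huniq⟩ := h
  have hset : G.neighborSet v = insert w (Subtype.val '' (G.induce T).neighborSet v) := by
    ext x
    simp only [SimpleGraph.mem_neighborSet, Set.mem_insert_iff, Set.mem_image,
      SimpleGraph.comap_adj, Function.Embedding.subtype_apply, Subtype.exists, exists_and_right,
      exists_eq_right]
    constructor
    · intro hx
      by_cases hxT : x ∈ T
      · exact Or.inr ⟨hxT, hx⟩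
      · exact Or.inl (huniq x ⟨hxT, hx⟩)
    · rintro (rfl | ⟨_, hx⟩)
      · exact hw
      · exact hx
  rw [hset, Set.ncard_insert_of_notMem, Set.ncard_image_of_injective _ Subtype.val_injective]
  rintro ⟨y, -, rfl⟩
  exact hwT y.2

theorem IsHL.ncard_neighborSet {n : ℕ} : ∀ {V : Type} [Fintype V] [DecidableEq V]
    {G : SimpleGraph V}, IsHL n G → ∀ v, (G.neighborSet v).ncard = n := by
  induction n with
  | zero =>
    intro V _ _ G hG v
    have hV : Fintype.card V = 1 := hG
    have := Fintype.card_le_one_iff_subsingleton.mp hV.le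
    rw [Set.ncard_eq_zero, Set.eq_empty_iff_forall_notMem]
    exact fun w hw => hw.ne (Subsingleton.elim _ _)
  | succ n ih =>
    intro V _ _ G hG v
    obtain ⟨S, h1, h2, hS, hSc⟩ := hG
    by_cases hv : v ∈ S
    · rw [ncard_neighborSet_of_existsUnique_notMem G (S : Set V) ⟨v, hv⟩
        (by simpa using hS v hv), ih h1]
    · rw [ncard_neighborSet_of_existsUnique_notMem G ((Sᶜ : Finset V) : Set V)
        ⟨v, by simpa using hv⟩ (by simpa using hSc v hv), ih h2]

theorem IsHL.card {n : ℕ} : ∀ {V : Type} [Fintype V] [DecidableEq V]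
    {G : SimpleGraph V}, IsHL n G → Fintype.card V = 2 ^ n := by
  induction n with
  | zero => exact fun hG => hG
  | succ n ih =>
    intro V _ _ G hG
    obtain ⟨S, h1, h2, -, -⟩ := hG
    have e1 := ih h1
    have e2 := ih h2
    rw [← Nat.card_eq_fintype_card, Nat.card_coe_set_eq, Set.ncard_coe_finset] at e1 e2
    rw [← Finset.card_add_card_compl S, e1, e2]
    ring

/-- An `n`-dimensional HL-network contains, for each `r ≤ n`, an `r`-regular induced subgraph on
`2 ^ r` vertices such that every other vertex has at most one neighbour in it. -/
theorem IsHL.exists_subnetwork {n : ℕ} : ∀ {V : Type} [Fintype V] [DecidableEq V]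
    {G : SimpleGraph V}, IsHL n G → ∀ r ≤ n, ∃ A : Set V, A.ncard = 2 ^ r ∧
      (∀ a ∈ A, (G.neighborSet a ∩ A).ncard = r) ∧
      ∀ v ∉ A, (G.neighborSet v ∩ A).Subsingleton := by
  induction n with
  | zero =>
    intro V _ _ G hG r hr
    obtain rfl : r = 0 := by omega
    refine ⟨Set.univ, ?_, fun a _ => ?_, by simp⟩
    · rw [Set.ncard_univ, Nat.card_eq_fintype_card, hG.card]
    · rw [Set.inter_univ, hG.ncard_neighborSet]
  | succ n ih =>
    intro V _ _ G hG r hr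
    rcases hr.eq_or_lt with rfl | hr
    · refine ⟨Set.univ, ?_, fun a _ => ?_, by simp⟩
      · rw [Set.ncard_univ, Nat.card_eq_fintype_card, hG.card]
      · rw [Set.inter_univ, hG.ncard_neighborSet]
    obtain ⟨S, h1, -, -, hSc⟩ := hG
    obtain ⟨A, hcard, hreg, hsub⟩ := ih h1 r (by omega)
    have himage (v : (S : Set V)) : G.neighborSet v ∩ Subtype.val '' A =
        Subtype.val '' ((G.induce (S : Set V)).neighborSet v ∩ A) := by
      ext x
      simp only [Set.mem_inter_iff, Set.mem_image, SimpleGraph.mem_neighborSet,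
        SimpleGraph.comap_adj, Function.Embedding.subtype_apply]
      constructor
      · rintro ⟨hx, y, hy, rfl⟩
        exact ⟨y, ⟨hx, hy⟩, rfl⟩
      · rintro ⟨y, ⟨hx, hy⟩, rfl⟩
        exact ⟨hx, y, hy, rfl⟩
    refine ⟨Subtype.val '' A, ?_, ?_, ?_⟩
    · rw [Set.ncard_image_of_injective _ Subtype.val_injective, hcard]
    · rintro _ ⟨a, ha, rfl⟩
      rw [himage, Set.ncard_image_of_injective _ Subtype.val_injective, hreg a ha]
    · intro v hv
      by_cases hvS : v ∈ S
      · have := himage ⟨v, hvS⟩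
        simp only at this
        rw [this]
        exact (hsub ⟨v, hvS⟩ fun h => hv ⟨_, h, rfl⟩).image _
      · rintro x ⟨hx, a, -, rfl⟩ y ⟨hy, b, -, rfl⟩
        exact (hSc v hvS).unique ⟨a.2, hx⟩ ⟨b.2, hy⟩

/-- The edges between `A` and its complement. -/
def edgeBoundary {V : Type} (G : SimpleGraph V) (A : Set V) : Set (Sym2 V) :=
  {e | ∃ a ∈ A, ∃ b ∉ A, G.Adj a b ∧ e = s(a, b)}

theorem mk_mem_edgeBoundary {V : Type} {G : SimpleGraph V} {A : Set V} {a b : V} :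
    s(a, b) ∈ edgeBoundary G A ↔ G.Adj a b ∧ (a ∈ A ∧ b ∉ A ∨ b ∈ A ∧ a ∉ A) := by
  constructor
  · rintro ⟨x, hx, y, hy, hxy, he⟩
    rcases Sym2.eq_iff.mp he with ⟨rfl, rfl⟩ | ⟨rfl, rfl⟩
    · exact ⟨hxy, Or.inl ⟨hx, hy⟩⟩
    · exact ⟨hxy.symm, Or.inr ⟨hx, hy⟩⟩
  · rintro ⟨hab, ⟨ha, hb⟩ | ⟨hb, ha⟩⟩
    · exact ⟨a, ha, b, hb, hab, rfl⟩
    · exact ⟨b, hb, a, ha, hab.symm, Sym2.eq_swap⟩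

theorem edgeBoundary_subset_edgeSet {V : Type} (G : SimpleGraph V) (A : Set V) :
    edgeBoundary G A ⊆ G.edgeSet := by
  rintro _ ⟨a, -, b, -, hab, rfl⟩
  exact hab

theorem ncard_edgeBoundary {V : Type} [Finite V] (G : SimpleGraph V) (A : Set V) (k : ℕ)
    (h : ∀ a ∈ A, (G.neighborSet a \ A).ncard = k) :
    (edgeBoundary G A).ncard = A.ncard * k := by
  classical
  have := Fintype.ofFinite V
  have hset : edgeBoundary G A =
      ((A.toFinset.sigma fun a => (G.neighborSet a \ A).toFinset).image
        fun p => s(p.1, p.2) : Finset (Sym2 V)) := by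
    ext e
    simp only [edgeBoundary, Set.mem_ofPred_eq, Finset.coe_image, Set.mem_image, Finset.mem_coe,
      Finset.mem_sigma, Set.mem_toFinset, Set.mem_sdiff, SimpleGraph.mem_neighborSet]
    constructor
    · rintro ⟨a, ha, b, hb, hab, rfl⟩
      exact ⟨⟨a, b⟩, ⟨ha, hab, hb⟩, rfl⟩
    · rintro ⟨⟨a, b⟩, ⟨ha, hab, hb⟩, rfl⟩
      exact ⟨a, ha, b, hb, hab, rfl⟩
  rw [hset, Set.ncard_coe_finset, Finset.card_image_of_injOn, Finset.card_sigma,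
    Finset.sum_const_nat (m := k), Set.ncard_eq_toFinset_card']
  · intro a ha
    rw [← Set.ncard_eq_toFinset_card']
    exact h a (by simpa using ha)
  · rintro ⟨a, b⟩ hp ⟨c, d⟩ hq he
    simp only [Finset.coe_sigma, Set.mem_sigma_iff, Finset.mem_coe, Set.mem_toFinset,
      Set.mem_sdiff] at hp hq
    rcases Sym2.eq_iff.mp he with ⟨h1, h2⟩ | ⟨h1, h2⟩
    · subst h1 h2
      rfl
    · dsimp only at h1
      exact absurd (h1 ▸ hp.1) hq.2.2

/-- If no edge of `H` leaves `A`, no vertex of `A` reaches a vertex outside `A`. -/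
theorem not_reachable_of_forall_not_adj {V : Type} {H : SimpleGraph V} {A : Set V}
    (h : ∀ a ∈ A, ∀ b ∉ A, ¬ H.Adj a b) {u v : V} (hu : u ∈ A) (hv : v ∉ A) :
    ¬ H.Reachable u v := by
  rintro ⟨p⟩
  obtain ⟨d, hd, h1, h2⟩ := p.exists_boundary_dart A hu hv
  exact h _ h1 _ h2 d.adj

/-- Edge-fault-tolerance of the SM-λ property of HL-networks (upper bound direction):
for `G ∈ HL_n` there is an edge set `F` with `|F| = 2^r (n - r) - n + 1` and
`δ(G - F) ≥ r`, yet `G - F` is not SM-λ. -/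
theorem exists_edgeSet_not_smLambda_HL
    {n r : ℕ} (hn : 3 ≤ n) (hr1 : 1 ≤ r) (hr2 : r + 2 ≤ n)
    {V : Type} [Fintype V] [DecidableEq V] (G : SimpleGraph V) (hG : IsHL n G) :
    ∃ F : Set (Sym2 V), F ⊆ G.edgeSet ∧
      (F.ncard : ℤ) = 2 ^ r * ((n : ℤ) - r) - n + 1 ∧
      (∀ v : V, r ≤ ((G.deleteEdges F).neighborSet v).ncard) ∧
      ¬ IsSMLambda (G.deleteEdges F) := by
  obtain ⟨A, hcard, hreg, hsub⟩ := hG.exists_subnetwork r (by omega)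
  have hout (a : V) (ha : a ∈ A) : (G.neighborSet a \ A).ncard = n - r := by
    have := Set.ncard_inter_add_ncard_sdiff_eq_ncard (G.neighborSet a) A (Set.toFinite _)
    rw [hreg a ha, hG.ncard_neighborSet] at this
    omega
  have hB := ncard_edgeBoundary G A (n - r) hout
  rw [hcard] at hB
  obtain ⟨u, hu⟩ : A.Nonempty := by
    rw [← Set.ncard_pos, hcard]
    positivity
  obtain ⟨v, huv, hv⟩ : (G.neighborSet u \ A).Nonempty := by
    rw [← Set.ncard_pos, hout u hu]
    omega
  have hle : n - 1 ≤ 2 ^ r * (n - r) := by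
    obtain ⟨m, rfl⟩ := Nat.exists_eq_add_of_le hr2
    have h2r : r + 1 ≤ 2 ^ r := Nat.lt_two_pow_self
    rw [show r + 2 + m - r = m + 2 by omega]
    calc r + 2 + m - 1 ≤ (r + 1) * (m + 2) := by
          rw [Nat.sub_le_iff_le_add]
          nlinarith
      _ ≤ _ := Nat.mul_le_mul_right _ h2r
  -- The boundary edges at `u` are kept, so both `u` and `v` keep all their neighbours.
  obtain ⟨D, huD, hDB, hDcard⟩ : ∃ D, (fun w => s(u, w)) '' (G.neighborSet u \ A) ⊆ D ∧
      D ⊆ edgeBoundary G A ∧ D.ncard = n - 1 := by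
    refine Set.exists_subsuperset_card_eq ?_ ?_ (hB ▸ hle)
    · rintro _ ⟨w, ⟨hw, hwA⟩, rfl⟩
      exact ⟨u, hu, w, hwA, hw, rfl⟩
    · refine (Set.ncard_image_le (Set.toFinite _)).trans ?_
      rw [hout u hu]
      omega
  have hBG := edgeBoundary_subset_edgeSet G A
  have hnbr (x : V) (hx : ∀ w, s(x, w) ∈ edgeBoundary G A → s(x, w) ∈ D) :
      ((G.deleteEdges (edgeBoundary G A \ D)).neighborSet x).ncard = n := by
    rw [← hG.ncard_neighborSet x]
    congr 1
    ext w
    simp only [SimpleGraph.mem_neighborSet, SimpleGraph.deleteEdges_adj, Set.mem_sdiff]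
    exact ⟨fun h => h.1, fun h => ⟨h, fun h' => h'.2 (hx w h'.1)⟩⟩
  refine ⟨edgeBoundary G A \ D, Set.sdiff_subset.trans hBG, ?_, fun x => ?_, fun hSM => ?_⟩
  · have := Set.ncard_sdiff_add_ncard_of_subset hDB
    rw [hB, hDcard] at this
    zify [show r ≤ n by omega, show 1 ≤ n by omega] at this
    linarith
  · by_cases hx : x ∈ A
    · rw [← hreg x hx]
      refine Set.ncard_le_ncard ?_
      rintro w ⟨hw, hwA⟩
      refine (SimpleGraph.deleteEdges_adj ..).mpr ⟨hw, fun h => ?_⟩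
      have := mk_mem_edgeBoundary.mp h.1
      tauto
    · have hsplit :=
        Set.ncard_inter_add_ncard_sdiff_eq_ncard (G.neighborSet x) A (Set.toFinite _)
      have hone := Set.ncard_le_one_iff_subsingleton.mpr (hsub x hx)
      rw [hG.ncard_neighborSet] at hsplit
      have : (G.neighborSet x \ A).ncard ≤
          ((G.deleteEdges (edgeBoundary G A \ D)).neighborSet x).ncard := by
        refine Set.ncard_le_ncard ?_
        rintro w ⟨hw, hwA⟩
        refine (SimpleGraph.deleteEdges_adj ..).mpr ⟨hw, fun h => ?_⟩
        have := mk_mem_edgeBoundary.mp h.1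
        tauto
      omega
  · refine not_reachable_of_forall_not_adj ?_ hu hv
      (hSM.2 u v (fun h => hv (h ▸ hu)) D (fun e he => ?_) ?_)
    · intro a ha b hb hab
      simp only [SimpleGraph.deleteEdges_adj, Set.mem_sdiff] at hab
      have : s(a, b) ∈ edgeBoundary G A := ⟨a, ha, b, hb, hab.1.1, rfl⟩
      tauto
    · rw [SimpleGraph.edgeSet_deleteEdges]
      exact ⟨hBG (hDB he), fun h => h.2 he⟩
    · rw [hnbr u, hnbr v, hDcard]
      · omega
      · intro w hw
        obtain ⟨hvw, h⟩ := mk_mem_edgeBoundary.mp hw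
        have hwA : w ∈ A := by tauto
        obtain rfl := hsub v hv ⟨hvw, hwA⟩ ⟨G.adj_symm huv, hu⟩
        exact huD ⟨v, ⟨huv, hv⟩, Sym2.eq_swap⟩
      · intro w hw
        obtain ⟨huw, h⟩ := mk_mem_edgeBoundary.mp hw
        exact huD ⟨w, ⟨huw, by tauto⟩, rfl⟩
end

section
/- Let n ≥ 1 and let r, g be integers with 0 ≤ r ≤ n−1 and 2^r ≤ g ≤ 2^{n−1}. Write g in binary as g = Σ_{i=0}^s 2^{t_i} with t_0 > t_1 > ... > t_s ≥ 0, and set 2·e_g = Σ_{i=0}^s (t_i + 2i)·2^{t_i}. Then n·g − 2·e_g ≥ 2^r·(n−r). -/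
theorem sum_two_pow_lt_of_strictAnti {s : ℕ} {t : Fin s → ℕ} (ht : StrictAnti t) {a : ℕ}
    (ha : ∀ i, t i < a) : ∑ i, 2 ^ t i < 2 ^ a := by
  induction s generalizing a with
  | zero => simp
  | succ s ih =>
    rw [Fin.sum_univ_succ]
    have h := ih (t := fun i => t i.succ) (fun i j hij => ht (Fin.succ_lt_succ_iff.2 hij))
      (fun i => ht (Fin.succ_pos i))
    have hpow : 2 ^ (t 0 + 1) ≤ 2 ^ a := Nat.pow_le_pow_right two_pos (ha 0)
    rw [pow_succ] at hpow
    omega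

theorem sum_add_two_mul_succ_mul_two_pow {s : ℕ} (t : Fin (s + 1) → ℕ) :
    ∑ i : Fin (s + 1), ((t i : ℤ) + 2 * (i : ℕ)) * 2 ^ t i =
      t 0 * 2 ^ t 0 + ∑ i : Fin s, ((t i.succ : ℤ) + 2 * (i : ℕ)) * 2 ^ t i.succ +
        2 * ∑ i : Fin s, 2 ^ t i.succ := by
  rw [Fin.sum_univ_succ, Finset.mul_sum, add_assoc, ← Finset.sum_add_distrib]
  congr 1
  refine Finset.sum_congr rfl fun i _ => ?_
  push_cast [Fin.val_succ]
  ring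

/-- Arithmetic form of the bound `2 * e ≤ a * g` on the number `e` of edges induced by `g`
vertices of the `a`-dimensional cube. -/
theorem sum_add_two_mul_mul_two_pow_le {s : ℕ} {t : Fin s → ℕ} (ht : StrictAnti t) {a : ℕ}
    (ha : ∀ i, t i < a) :
    ∑ i : Fin s, ((t i : ℤ) + 2 * (i : ℕ)) * 2 ^ t i ≤ a * ∑ i, 2 ^ t i := by
  induction s generalizing a with
  | zero => simp
  | succ s ih =>
    have ht' : StrictAnti fun i : Fin s => t i.succ :=
      fun i j hij => ht (Fin.succ_lt_succ_iff.2 hij)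
    have hlt : ∀ i : Fin s, t i.succ < t 0 := fun i => ht (Fin.succ_pos i)
    have h := ih ht' hlt
    have hsum : (∑ i : Fin s, 2 ^ t i.succ : ℤ) < 2 ^ t 0 := by
      exact_mod_cast sum_two_pow_lt_of_strictAnti ht' hlt
    have hnonneg : (0 : ℤ) ≤ ∑ i : Fin s, 2 ^ t i.succ := by positivity
    have ha0 : (t 0 : ℤ) + 1 ≤ a := by exact_mod_cast ha 0
    rw [sum_add_two_mul_succ_mul_two_pow, Fin.sum_univ_succ]
    have hmul := mul_le_mul_of_nonneg_right ha0
      (add_nonneg (by positivity : (0 : ℤ) ≤ 2 ^ t 0) hnonneg)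
    linarith

theorem two_pow_mul_sub_le_two_pow_mul_sub {n r a : ℕ} (hra : r ≤ a) (han : a + 1 ≤ n) :
    2 ^ r * ((n : ℤ) - r) ≤ 2 ^ a * ((n : ℤ) - a) := by
  induction a, hra using Nat.le_induction with
  | base => rfl
  | succ a _ ih =>
    refine (ih (by omega)).trans ?_
    have han' : (a : ℤ) + 2 ≤ n := by exact_mod_cast han
    rw [pow_succ, mul_assoc]
    gcongr
    push_cast
    linarith


/-- Lemma 2.6: if `0 ≤ r ≤ n - 1` and `2^r ≤ g ≤ 2^(n-1)`, with binary expansion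
`g = ∑_{i=0}^s 2^(t i)` (`t 0 > t 1 > ... > t s ≥ 0`) and
`2 e_g = ∑_{i=0}^s (t i + 2 i) * 2^(t i)`, then `f(g) = n * g - 2 e_g ≥ f(2^r) = 2^r (n - r)`. -/
theorem f_ge_f_pow_of_binary_expansion
    (n r : ℕ) (hn : 1 ≤ n) (hr : r + 1 ≤ n)
    (g : ℕ) (hg1 : 2 ^ r ≤ g) (hg2 : g ≤ 2 ^ (n - 1))
    (s : ℕ) (t : Fin (s + 1) → ℕ) (ht : StrictAnti t)
    (hsum : g = ∑ i, 2 ^ (t i)) :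
    2 ^ r * ((n : ℤ) - r) ≤ (n : ℤ) * g - ∑ i : Fin (s + 1), ((t i : ℤ) + 2 * (i : ℕ)) * 2 ^ (t i) := by
  have ht' : StrictAnti fun i : Fin s => t i.succ :=
    fun i j hij => ht (Fin.succ_lt_succ_iff.2 hij)
  have hlt : ∀ i : Fin s, t i.succ < t 0 := fun i => ht (Fin.succ_pos i)
  have hr0 : r ≤ t 0 := by
    have h := sum_two_pow_lt_of_strictAnti ht (a := t 0 + 1)
      (fun i => Nat.lt_succ_of_le (ht.antitone (Fin.zero_le i)))
    rw [← hsum] at h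
    exact Nat.lt_succ_iff.1 ((Nat.pow_lt_pow_iff_right one_lt_two).1 (hg1.trans_lt h))
  rw [Fin.sum_univ_succ] at hsum
  have hn0 : t 0 + 1 ≤ n := by
    have h : t 0 ≤ n - 1 := (Nat.pow_le_pow_iff_right one_lt_two).1 (by omega)
    omega
  have htail := sum_add_two_mul_mul_two_pow_le ht' hlt
  have hpow := two_pow_mul_sub_le_two_pow_mul_sub hr0 hn0
  have hgap : (0 : ℤ) ≤ (n - t 0 - 2) * ∑ i : Fin s, 2 ^ t i.succ := by
    rcases hn0.eq_or_lt with h | h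
    · have hzero : ∑ i : Fin s, 2 ^ t i.succ = 0 := by
        have : n - 1 = t 0 := by omega
        rw [this] at hg2
        omega
      have hzero' : (∑ i : Fin s, 2 ^ t i.succ : ℤ) = 0 := by exact_mod_cast hzero
      simp [hzero']
    · have : (t 0 : ℤ) + 2 ≤ n := by exact_mod_cast h
      exact mul_nonneg (by linarith) (by positivity)
  rw [sum_add_two_mul_succ_mul_two_pow, hsum]
  push_cast
  linarith
end
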